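/- Let p be a prime and let A be a commutative Noetherian complete local ring with finite residue field 𝔽 of characteristic p (a pro-p ring), and let π : GL_n(A) → GL_n(𝔽) denote the reduction homomorphism induced by the quotient map onto the residue field. Let H be a finite subgroup of GL_n(A) whose order is coprime to p, and suppose that the 𝔽[H]-module 𝔽^n, where h ∈ H acts through the matrix π(h), is multiplicity-free, meaning that any two simple 𝔽[H]-submodules of 𝔽^n that are isomorphic as 𝔽[H]-modules are equal. Then any two elements g₁, g₂ ∈ GL_n(A) satisfying π(g₁) = π(g₂) = 1 and h g_i h^{-1} = g_i for all h ∈ H and i = 1, 2 commute with each other; in other words, the fixed-point subgroup of the conjugation action of H on the kernel of π is abelian. -/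

import Mathlib

section AdicLifting

variable {A C : Type*} [CommRing A] [Ring C] [Algebra A C] (I : Ideal A)

theorem LinearMap.mem_pow_add_smul_top (L : C →ₗ[A] C) {a b : ℕ}
    (hL : ∀ z, L z ∈ (I ^ a • ⊤ : Submodule A C)) {z : C}
    (hz : z ∈ (I ^ b • ⊤ : Submodule A C)) : L z ∈ (I ^ (b + a) • ⊤ : Submodule A C) := by
  have h := Submodule.mem_map_of_mem (f := L) hz
  rw [Submodule.map_smul''] at h
  rw [pow_add, ← smul_eq_mul, Submodule.smul_assoc]
  refine Submodule.smul_mono le_rfl ?_ h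
  rintro _ ⟨w, -, rfl⟩
  exact hL w

theorem mul_mem_pow_smul_top {k : ℕ} {z : C} (y : C) (hz : z ∈ (I ^ k • ⊤ : Submodule A C)) :
    y * z ∈ (I ^ k • ⊤ : Submodule A C) := by
  simpa using (LinearMap.mulLeft A y).mem_pow_add_smul_top I (a := 0) (by simp) hz

/-- The commutator `[z, y]` lies in `I ^ (b + a) C` if `z ∈ I ^ b C` and all commutators lie in
`I ^ a C`. -/
theorem commutator_mem_pow_add_smul_top {a b : ℕ}
    (h : ∀ x y : C, x * y - y * x ∈ (I ^ a • ⊤ : Submodule A C)) {z : C} (y : C)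
    (hz : z ∈ (I ^ b • ⊤ : Submodule A C)) :
    z * y - y * z ∈ (I ^ (b + a) • ⊤ : Submodule A C) :=
  (LinearMap.mulRight A y - LinearMap.mulLeft A y).mem_pow_add_smul_top I (fun z ↦ h z y) hz

/-- Modulo `I ^ (k + 1)`, the map `[·, z]` obeys the power rule of a derivation. -/
theorem commutator_pow_sub_mem {k : ℕ}
    (h₁ : ∀ x y : C, x * y - y * x ∈ (I ^ 1 • ⊤ : Submodule A C))
    (h : ∀ x y : C, x * y - y * x ∈ (I ^ k • ⊤ : Submodule A C)) (y z : C) (n : ℕ) :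
    (y ^ (n + 1) * z - z * y ^ (n + 1)) - ((n + 1 : ℕ) : A) • (y ^ n * (y * z - z * y)) ∈
      (I ^ (k + 1) • ⊤ : Submodule A C) := by
  induction n with
  | zero => simp
  | succ n ih =>
    convert add_mem (mul_mem_pow_smul_top I y ih)
      (commutator_mem_pow_add_smul_top I h₁ (y ^ (n + 1)) (h y z)) using 1
    simp only [pow_succ' y, Nat.cast_add, Nat.cast_one, add_smul, one_smul, mul_sub, mul_add,
      smul_sub, mul_smul_comm, sub_mul, mul_assoc]
    abel

/-- An algebra that is separated for the `I`-adic topology is commutative as soon as it is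
commutative modulo `I`, with surjective Frobenius modulo `I`. -/
theorem commute_of_frobenius_surjective {p : ℕ} (hp : p.Prime) (hpI : (p : A) ∈ I)
    (hI : (⨅ k : ℕ, I ^ k • ⊤ : Submodule A C) = ⊥)
    (hcomm : ∀ x y : C, x * y - y * x ∈ (I • ⊤ : Submodule A C))
    (hfrob : ∀ x : C, ∃ y : C, x - y ^ p ∈ (I • ⊤ : Submodule A C)) (x z : C) :
    x * z = z * x := by
  rw [← pow_one I] at hcomm hfrob
  suffices h : ∀ k : ℕ, ∀ x z : C, x * z - z * x ∈ (I ^ (k + 1) • ⊤ : Submodule A C) by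
    rw [← sub_eq_zero, ← Submodule.mem_bot A, ← hI, Submodule.mem_iInf]
    intro k
    exact Submodule.smul_mono_left (Ideal.pow_le_pow_right k.le_succ) (h k x z)
  intro k
  induction k with
  | zero => simpa using hcomm
  | succ k ih =>
    intro x z
    obtain ⟨y, hy⟩ := hfrob x
    have h₁ := commutator_mem_pow_add_smul_top I ih z hy
    rw [add_comm 1] at h₁
    have h₂ := commutator_pow_sub_mem I hcomm ih y z (p - 1)
    have h₃ : (p : A) • (y ^ (p - 1) * (y * z - z * y)) ∈
        (I ^ (k + 1 + 1) • ⊤ : Submodule A C) := by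
      rw [pow_succ' I, ← smul_eq_mul, Submodule.smul_assoc]
      exact Submodule.smul_mem_smul hpI (mul_mem_pow_smul_top I _ (ih y z))
    rw [Nat.sub_add_cancel hp.one_le] at h₂
    convert add_mem h₁ (add_mem h₂ h₃) using 1
    rw [sub_add_cancel, sub_mul, mul_sub]
    abel

end AdicLifting

theorem pow_surjective_of_finite_of_isReduced {E : Type*} [Ring E] [Finite E] [IsReduced E]
    (hE : ∀ x y : E, x * y = y * x) {p : ℕ} (hp : p.Prime) (hpE : (p : E) = 0) :
    Function.Surjective fun x : E ↦ x ^ p := by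
  refine Finite.injective_iff_surjective.mp fun x y (hxy : x ^ p = y ^ p) ↦ ?_
  obtain ⟨r, hr⟩ := Commute.exists_add_pow_prime_eq hp (show Commute (x - y) y from hE _ _)
  rw [sub_add_cancel, hpE, zero_mul, zero_mul, zero_mul, add_zero, hxy, right_eq_add] at hr
  exact sub_eq_zero.mp (IsReduced.eq_zero _ ⟨p, hr⟩)

section MultiplicityFree

/-- A module is multiplicity-free if isomorphic simple submodules are equal. -/
def IsMultiplicityFree (R M : Type*) [Ring R] [AddCommGroup M] [Module R M] : Prop :=
  ∀ S T : Submodule R M, IsSimpleModule R S → IsSimpleModule R T →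
    Nonempty (S ≃ₗ[R] T) → S = T

variable {R M : Type*} [Ring R] [AddCommGroup M] [Module R M]

theorem IsMultiplicityFree.mapsTo (hM : IsMultiplicityFree R M) (f : Module.End R M)
    (S : Submodule R M) [IsSimpleModule R S] : ∀ x ∈ S, f x ∈ S := by
  intro x hx
  obtain inj | eq := (f ∘ₗ S.subtype).injective_or_eq_zero
  · let e := LinearEquiv.ofInjective _ inj
    have : S = LinearMap.range (f ∘ₗ S.subtype) :=
      hM _ _ inferInstance (IsSimpleModule.congr e.symm) ⟨e⟩
    rw [this]
    exact ⟨⟨x, hx⟩, rfl⟩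
  · have : f x = 0 := LinearMap.congr_fun eq ⟨x, hx⟩
    exact this ▸ S.zero_mem

theorem LinearMap.ext_of_simple [IsSemisimpleModule R M] {f g : Module.End R M}
    (h : ∀ S : Submodule R M, IsSimpleModule R S → ∀ x ∈ S, f x = g x) : f = g := by
  rw [← LinearMap.eqLocus_eq_top, eq_top_iff, ← IsSemisimpleModule.sSup_simples_eq_top R M]
  exact sSup_le h

theorem IsMultiplicityFree.end_mul_comm [IsSemisimpleModule R M] [Finite M]
    (hM : IsMultiplicityFree R M) (f g : Module.End R M) : f * g = g * f := by
  classical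
  refine LinearMap.ext_of_simple fun S hS x hx ↦ ?_
  have : Finite (Module.End R S) := DFunLike.finite _
  have h := (Finite.isDomain_to_isField (Module.End R S)).mul_comm
    (f.restrict (hM.mapsTo f S)) (g.restrict (hM.mapsTo g S))
  exact congrArg Subtype.val (LinearMap.congr_fun h ⟨x, hx⟩)

theorem IsMultiplicityFree.isReduced_end [IsSemisimpleModule R M]
    (hM : IsMultiplicityFree R M) : IsReduced (Module.End R M) := by
  classical
  refine ⟨fun f ⟨k, hk⟩ ↦ LinearMap.ext_of_simple fun S hS x hx ↦ ?_⟩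
  have h : f.restrict (hM.mapsTo f S) = 0 := by
    refine eq_zero_of_pow_eq_zero (n := k) ?_
    rw [Module.End.pow_restrict]
    ext y
    simp [hk]
  exact congrArg Subtype.val (LinearMap.congr_fun h ⟨x, hx⟩)

end MultiplicityFree

section Matrix

open IsLocalRing

variable {A : Type*} [CommRing A] {n : ℕ} (H : Subgroup (GL (Fin n) A))

/-- The algebra of matrices that commute with every element of `H`. -/
def matrixCentralizer : Subalgebra A (Matrix (Fin n) (Fin n) A) :=
  Subalgebra.centralizer A ((fun g : GL (Fin n) A ↦ (g : Matrix (Fin n) (Fin n) A)) '' H)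

variable {H} in
theorem mem_matrixCentralizer {M : Matrix (Fin n) (Fin n) A} :
    M ∈ matrixCentralizer H ↔ ∀ h : H, ((h : GL (Fin n) A) : Matrix (Fin n) (Fin n) A) * M =
      M * ((h : GL (Fin n) A) : Matrix (Fin n) (Fin n) A) := by
  simp [matrixCentralizer, Subalgebra.mem_centralizer_iff]

/-- The sum of all conjugates of a matrix under a finite matrix group. -/
noncomputable def conjugateSum [Fintype H] :
    Matrix (Fin n) (Fin n) A →ₗ[A] matrixCentralizer H :=
  LinearMap.codRestrict (matrixCentralizer H).toSubmodule
    (∑ h : H, LinearMap.mulLeft A ((h : GL (Fin n) A) : Matrix (Fin n) (Fin n) A) ∘ₗ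
      LinearMap.mulRight A (((h : GL (Fin n) A)⁻¹ : GL (Fin n) A) : Matrix (Fin n) (Fin n) A))
    (by
      intro M
      rw [Subalgebra.mem_toSubmodule, mem_matrixCentralizer]
      intro k
      simp only [LinearMap.sum_apply, LinearMap.comp_apply, LinearMap.mulLeft_apply,
        LinearMap.mulRight_apply, Finset.mul_sum, Finset.sum_mul]
      refine Fintype.sum_equiv (Equiv.mulLeft k) _ _ fun h ↦ ?_
      simp only [Equiv.coe_mulLeft, Subgroup.coe_mul, mul_inv_rev, Units.val_mul, mul_assoc,
        Units.inv_mul, mul_one])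

theorem coe_conjugateSum [Fintype H] (M : Matrix (Fin n) (Fin n) A) :
    (conjugateSum H M : Matrix (Fin n) (Fin n) A) =
      ∑ h : H, ((h : GL (Fin n) A) : Matrix (Fin n) (Fin n) A) *
        (M * (((h : GL (Fin n) A)⁻¹ : GL (Fin n) A) : Matrix (Fin n) (Fin n) A)) :=
  LinearMap.sum_apply _ _ _

theorem conjugateSum_apply_coe [Fintype H] (x : matrixCentralizer H) :
    conjugateSum H (x : Matrix (Fin n) (Fin n) A) = (Fintype.card H : A) • x := by
  ext1
  simp only [coe_conjugateSum, ← mul_assoc, mem_matrixCentralizer.mp x.2]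
  simp only [mul_assoc, Units.mul_inv, mul_one, Finset.sum_const, Finset.card_univ,
    Subalgebra.coe_smul, Nat.cast_smul_eq_nsmul]

theorem Matrix.mem_smul_top {I : Ideal A} {M : Matrix (Fin n) (Fin n) A}
    (hM : ∀ i j, M i j ∈ I) : M ∈ (I • ⊤ : Submodule A (Matrix (Fin n) (Fin n) A)) := by
  rw [Matrix.matrix_eq_sum_single M]
  refine sum_mem fun i _ ↦ sum_mem fun j _ ↦ ?_
  rw [← mul_one (M i j), ← smul_eq_mul, ← Matrix.smul_single]
  exact Submodule.smul_mem_smul (hM i j) trivial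

/-- If `|H|` is invertible, an element of the centralizer of `H` with entries in an ideal `I` is a
combination of elements of the centralizer with coefficients in `I`. -/
theorem matrixCentralizer.mem_smul_top [Finite H] (hH : IsUnit (Nat.card H : A)) {I : Ideal A}
    {x : matrixCentralizer H} (hx : ∀ i j, (x : Matrix (Fin n) (Fin n) A) i j ∈ I) :
    x ∈ (I • ⊤ : Submodule A (matrixCentralizer H)) := by
  have := Fintype.ofFinite H
  have h := Submodule.mem_map_of_mem (f := conjugateSum H) (Matrix.mem_smul_top hx)
  rw [Submodule.map_smul'', conjugateSum_apply_coe, ← Nat.card_eq_fintype_card] at h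
  rw [← Submodule.smul_mem_iff_of_isUnit _ hH]
  exact Submodule.smul_mono le_rfl le_top h

variable [IsLocalRing A]
  (ρ : Representation (ResidueField A) H (Fin n → ResidueField A))

/-- A matrix commuting with `H` acts on the residual representation by endomorphisms. -/
noncomputable def matrixCentralizer.toEnd
    (hρ : ∀ (h : H) (v : Fin n → ResidueField A),
      ρ h v = Matrix.mulVec (((h : GL (Fin n) A) : Matrix (Fin n) (Fin n) A).map (residue A)) v) :
    matrixCentralizer H →+* Module.End (MonoidAlgebra (ResidueField A) H) ρ.asModule :=
  (Representation.IntertwiningMap.equivAlgEnd (ρ := ρ)).toRingEquiv.toRingHom.comp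
    { toFun := fun x ↦ LinearMap.intertwiningMap_of_isIntertwiningMap ρ ρ
        (Matrix.mulVecLin ((x : Matrix (Fin n) (Fin n) A).map (residue A))) fun h v ↦ by
          rw [hρ, hρ, Matrix.mulVecLin_apply, Matrix.mulVecLin_apply, Matrix.mulVec_mulVec,
            Matrix.mulVec_mulVec, ← Matrix.map_mul, ← Matrix.map_mul,
            mem_matrixCentralizer.mp x.2 h]
      map_one' := by
        apply Representation.IntertwiningMap.toLinearMap_injective
        exact LinearMap.ext fun v ↦ by
          simp [LinearMap.intertwiningMap_of_isIntertwiningMap]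
      map_mul' := fun x y ↦ by
        apply Representation.IntertwiningMap.toLinearMap_injective
        exact LinearMap.ext fun v ↦ by
          simp [LinearMap.intertwiningMap_of_isIntertwiningMap]
      map_zero' := by
        apply Representation.IntertwiningMap.toLinearMap_injective
        exact LinearMap.ext fun v ↦ by
          simp [LinearMap.intertwiningMap_of_isIntertwiningMap]
      map_add' := fun x y ↦ by
        apply Representation.IntertwiningMap.toLinearMap_injective
        exact LinearMap.ext fun v ↦ by
          simp [LinearMap.intertwiningMap_of_isIntertwiningMap, Matrix.map_add] }

theorem matrixCentralizer.toEnd_apply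
    (hρ : ∀ (h : H) (v : Fin n → ResidueField A),
      ρ h v = Matrix.mulVec (((h : GL (Fin n) A) : Matrix (Fin n) (Fin n) A).map (residue A)) v)
    (x : matrixCentralizer H) (v : Fin n → ResidueField A) :
    ρ.asModuleEquiv (toEnd H ρ hρ x (ρ.asModuleEquiv.symm v)) =
      ((x : Matrix (Fin n) (Fin n) A).map (residue A)).mulVec v :=
  rfl

theorem matrixCentralizer.mem_smul_top_of_toEnd_eq_zero [Finite H]
    (hH : IsUnit (Nat.card H : A))
    (hρ : ∀ (h : H) (v : Fin n → ResidueField A),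
      ρ h v = Matrix.mulVec (((h : GL (Fin n) A) : Matrix (Fin n) (Fin n) A).map (residue A)) v)
    {x : matrixCentralizer H} (hx : toEnd H ρ hρ x = 0) :
    x ∈ (maximalIdeal A • ⊤ : Submodule A (matrixCentralizer H)) := by
  have h : (x : Matrix (Fin n) (Fin n) A).map (residue A) = 0 := by
    refine Matrix.ext_of_mulVec_single fun j ↦ ?_
    rw [← toEnd_apply H ρ hρ, hx, Matrix.zero_mulVec, LinearMap.zero_apply, map_zero]
  refine mem_smul_top H hH fun i j ↦ ?_
  rw [← residue_eq_zero_iff]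
  exact congrFun (congrFun h i) j

end Matrix


/-- Let `A` be a pro-`p` ring (commutative Noetherian complete local
ring with finite residue field `𝔽` of characteristic `p`), and let
`π : GL n A →* GL n 𝔽` be the reduction map.  Let `H ≤ GL n A` be a finite subgroup
of order coprime to `p`, and suppose the `𝔽[H]`-module `𝔽ⁿ`, with `h` acting through
the matrix `π h`, is multiplicity-free.  Then any two elements of the kernel of `π`
that are fixed by conjugation by every element of `H` commute. -/
theorem stmt_14 (p : ℕ) (hp : p.Prime) (A : Type*) [CommRing A] [IsNoetherianRing A]
    [IsLocalRing A] [IsAdicComplete (IsLocalRing.maximalIdeal A) A]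
    [Finite (IsLocalRing.ResidueField A)] [CharP (IsLocalRing.ResidueField A) p]
    (n : ℕ)
    (π : GL (Fin n) A →* GL (Fin n) (IsLocalRing.ResidueField A))
    (hπ : π = Matrix.GeneralLinearGroup.map (IsLocalRing.residue A))
    (H : Subgroup (GL (Fin n) A)) [Finite H] (hH : (Nat.card H).Coprime p)
    (ρ : Representation (IsLocalRing.ResidueField A) H
      (Fin n → IsLocalRing.ResidueField A))
    (hρ : ∀ (h : H) (v : Fin n → IsLocalRing.ResidueField A),
      ρ h v = Matrix.mulVec (π (h : GL (Fin n) A) : Matrix (Fin n) (Fin n)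
        (IsLocalRing.ResidueField A)) v)
    (hmf : ∀ S T : Submodule
        (MonoidAlgebra (IsLocalRing.ResidueField A) H) ρ.asModule,
      IsSimpleModule (MonoidAlgebra (IsLocalRing.ResidueField A) H) S →
      IsSimpleModule (MonoidAlgebra (IsLocalRing.ResidueField A) H) T →
      Nonempty (S ≃ₗ[MonoidAlgebra (IsLocalRing.ResidueField A) H] T) → S = T)
    (g₁ g₂ : GL (Fin n) A) (hg₁ : π g₁ = 1) (hg₂ : π g₂ = 1)
    (hfix₁ : ∀ h : H, (h : GL (Fin n) A) * g₁ * (h : GL (Fin n) A)⁻¹ = g₁)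
    (hfix₂ : ∀ h : H, (h : GL (Fin n) A) * g₂ * (h : GL (Fin n) A)⁻¹ = g₂) :
    g₁ * g₂ = g₂ * g₁ := by
  subst hπ
  have hpF : (p : IsLocalRing.ResidueField A) = 0 := CharP.cast_eq_zero _ p
  have hcard : (Nat.card H : IsLocalRing.ResidueField A) ≠ 0 := fun h ↦
    hp.one_lt.ne' (Nat.eq_one_of_dvd_coprimes hH
      ((CharP.cast_eq_zero_iff (IsLocalRing.ResidueField A) p _).mp h) dvd_rfl)
  have : NeZero (Nat.card H : IsLocalRing.ResidueField A) := ⟨hcard⟩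
  have hunit : IsUnit (Nat.card H : A) := by
    rw [← IsLocalRing.residue_ne_zero_iff_isUnit, map_natCast]
    exact hcard
  have hpm : (p : A) ∈ IsLocalRing.maximalIdeal A := by
    rw [← IsLocalRing.residue_eq_zero_iff, map_natCast, hpF]
  have : Finite ρ.asModule := inferInstanceAs (Finite (Fin n → IsLocalRing.ResidueField A))
  let E := Module.End (MonoidAlgebra (IsLocalRing.ResidueField A) H) ρ.asModule
  have : Finite E := DFunLike.finite _
  have hM : IsMultiplicityFree (MonoidAlgebra (IsLocalRing.ResidueField A) H) ρ.asModule := hmf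
  have : IsReduced E := hM.isReduced_end
  let φ : matrixCentralizer H →+* E := matrixCentralizer.toEnd H ρ hρ
  have hφ (x : matrixCentralizer H) (hx : φ x = 0) :
      x ∈ (IsLocalRing.maximalIdeal A • ⊤ : Submodule A (matrixCentralizer H)) :=
    matrixCentralizer.mem_smul_top_of_toEnd_eq_zero H ρ hunit hρ hx
  have hpφ : φ (p : matrixCentralizer H) = 0 := by
    rw [map_natCast]
    refine LinearMap.ext fun v ↦ ?_
    rw [Module.End.natCast_apply, ← Nat.cast_smul_eq_nsmul (IsLocalRing.ResidueField A), hpF,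
      zero_smul, LinearMap.zero_apply]
  let T : Subring E := φ.range
  have hcomm (x y : T) : x * y = y * x := Subtype.ext (hM.end_mul_comm x.1 y.1)
  have : IsReduced T := isReduced_of_injective T.subtype Subtype.val_injective
  have : Module.Finite A (matrixCentralizer H) :=
    Module.Finite.of_injective (matrixCentralizer H).val.toLinearMap Subtype.val_injective
  have key := commute_of_frobenius_surjective (C := matrixCentralizer H) _ hp hpm
    (Ideal.iInf_pow_smul_eq_bot_of_isLocalRing _ (Ideal.IsPrime.ne_top inferInstance))
    (fun x y ↦ hφ _ (by rw [map_sub, map_mul, map_mul, hM.end_mul_comm, sub_self]))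
    (fun x ↦ by
      obtain ⟨⟨_, y, rfl⟩, hy⟩ := pow_surjective_of_finite_of_isReduced hcomm hp
        (Subtype.ext (by simpa using hpφ)) ⟨φ x, x, rfl⟩
      refine ⟨y, hφ _ ?_⟩
      rw [map_sub, map_pow, sub_eq_zero]
      exact (congrArg Subtype.val hy).symm)
  have hmem {g : GL (Fin n) A}
      (hg : ∀ h : H, (h : GL (Fin n) A) * g * (h : GL (Fin n) A)⁻¹ = g) :
      (g : Matrix (Fin n) (Fin n) A) ∈ matrixCentralizer H :=
    mem_matrixCentralizer.mpr fun h ↦ congrArg Units.val (mul_inv_eq_iff_eq_mul.mp (hg h))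
  exact Units.ext (congrArg Subtype.val (key ⟨g₁, hmem hfix₁⟩ ⟨g₂, hmem hfix₂⟩))
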